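/- Let c = (c₁,…,cₙ) ∈ 𝒜⁺ and let 1 ≤ e₁ < e₂ ≤ n be ears of c. Then the set { i ∈ {1,…,n} : φ_i(e₁) = φ_i(e₂) } has at most 2 elements. Moreover, if i < j are both in this set, then i < e₁ < j or i < e₂ < j; in particular j − i > 1. -/

import Mathlib

open Matrix Finset

/-- The matrix `η(a)` with rows `(a, -1)` and `(1, 0)`. -/
def etaM (a : ℤ) : Matrix (Fin 2) (Fin 2) ℤ := !![a, -1; 1, 0]

/-- The set `𝒜⁺` of η-sequences, as an inductive predicate on lists of integers. -/
inductive IsEta : List ℤ → Prop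
  | base : IsEta [0, 0]
  | rotate {c : List ℤ} : IsEta c → IsEta (c.rotate 1)
  | reverse {c : List ℤ} : IsEta c → IsEta c.reverse
  | expand {a b : ℤ} {t : List ℤ} : IsEta (a :: b :: t) → IsEta ((a + 1) :: 1 :: (b + 1) :: t)

/-- The `i`-th entry (1-indexed) of a sequence. -/
def entryOf (c : List ℤ) (i : ℕ) : ℤ := c.getD (i - 1) 0

/-- `φ_i(j)`: `0` if `i = j`; the (2,1)-entry of `η(c_i)⋯η(c_{j-1})` if `i < j`;
the (2,1)-entry of `η(c_j)⋯η(c_{i-1})` if `j < i`.  (Indices are 1-based.) -/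
def phi (c : List ℤ) (i j : ℕ) : ℤ :=
  if i = j then 0
  else if i < j then (((c.drop (i - 1)).take (j - i)).map etaM).prod 1 0
  else (((c.drop (j - 1)).take (i - j)).map etaM).prod 1 0

open Classical in
/-- `m_i`: the set of positions `j ∈ {1,…,n}` where `φ_i` attains its maximum. -/
noncomputable def mset (c : List ℤ) (i : ℕ) : Finset ℕ :=
  (Finset.Icc 1 c.length).filter (fun j => ∀ l ∈ Finset.Icc 1 c.length, phi c i l ≤ phi c i j)

/-- `i ⊕ k`: addition of 1-based indices, wrapping around modulo `n` (for `i + k ≤ 2n`). -/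
def addIdx (n i k : ℕ) : ℕ := if i + k ≤ n then i + k else i + k - n

/-- `c` is dense if for every `i ∈ {1,…,n}`, `|m_i| > 1` or `|m_{i+1}| > 1`
(indices taken cyclically). -/
def DenseSeq (c : List ℤ) : Prop :=
  ∀ i ∈ Finset.Icc 1 c.length,
    1 < (mset c i).card ∨ 1 < (mset c (addIdx c.length i 1)).card

/-- `c` is fan-shaped if a cyclic rotation of `c` equals `(n-2, 1, 2, …, 2, 1)`. -/
def IsFan (c : List ℤ) : Prop :=
  ∃ k, c.rotate k =
    ((c.length : ℤ) - 2) :: 1 :: (List.replicate (c.length - 3) (2 : ℤ) ++ [1])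

/-- The product `η(c₁)⋯η(cₖ)`. -/
def etaProd (l : List ℤ) : Matrix (Fin 2) (Fin 2) ℤ := (l.map etaM).prod

@[simp] lemma etaProd_nil : etaProd [] = 1 := rfl

@[simp] lemma etaProd_cons (a : ℤ) (l : List ℤ) : etaProd (a :: l) = etaM a * etaProd l := by
  simp [etaProd]

@[simp] lemma etaProd_append (l m : List ℤ) : etaProd (l ++ m) = etaProd l * etaProd m := by
  simp [etaProd]

lemma det_etaProd (l : List ℤ) : (etaProd l).det = 1 := by
  induction l with
  | nil => simp
  | cons a l ih => rw [etaProd_cons, det_mul, ih]; simp [etaM, det_fin_two]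

lemma etaProd_reverse (l : List ℤ) :
    etaProd l.reverse = !![1, 0; 0, -1] * (etaProd l)ᵀ * !![1, 0; 0, -1] := by
  induction l with
  | nil => ext i j; fin_cases i <;> fin_cases j <;> simp [mul_apply]
  | cons a l ih =>
    rw [List.reverse_cons, etaProd_append, ih, etaProd_cons]
    ext i j
    fin_cases i <;> fin_cases j <;>
      simp [mul_apply, vecMul, dotProduct, Fin.sum_univ_two, etaM] <;> ring

lemma etaProd_reverse_zero_zero (l : List ℤ) : etaProd l.reverse 0 0 = etaProd l 0 0 := by
  simp [etaProd_reverse, mul_apply, vecMul, dotProduct, Fin.sum_univ_two]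

lemma etaProd_cons_one_zero (a : ℤ) (l : List ℤ) : etaProd (a :: l) 1 0 = etaProd l 0 0 := by
  simp [etaM, mul_apply, Fin.sum_univ_two]

lemma etaProd_cons_zero_zero (a : ℤ) (l : List ℤ) :
    etaProd (a :: l) 0 0 = a * etaProd l 0 0 - etaProd l 1 0 := by
  simp [etaM, mul_apply, Fin.sum_univ_two]; ring

lemma etaProd_add_one_cons_zero_zero (a : ℤ) (l : List ℤ) :
    etaProd ((a + 1) :: l) 0 0 = etaProd (a :: l) 0 0 + etaProd l 0 0 := by
  rw [etaProd_cons_zero_zero, etaProd_cons_zero_zero]; ring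

lemma etaM_expand (a b : ℤ) : etaM (a + 1) * (etaM 1 * etaM (b + 1)) = etaM a * etaM b := by
  ext i j
  fin_cases i <;> fin_cases j <;> simp [mul_apply, Fin.sum_univ_two, etaM] ; ring

lemma etaProd_expand (a b : ℤ) (l : List ℤ) :
    etaProd ((a + 1) :: 1 :: (b + 1) :: l) = etaProd (a :: b :: l) := by
  simp only [etaProd_cons, ← mul_assoc]
  rw [mul_assoc (etaM (a + 1)), etaM_expand]

lemma mul_eq_neg_one_comm {A B : Matrix (Fin 2) (Fin 2) ℤ} (h : A * B = -1) : B * A = -1 := by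
  have h' : (-A) * B = 1 := by rw [neg_mul, h, neg_neg]
  have := mul_eq_one_comm.mp h'
  rw [mul_neg] at this
  rw [← neg_neg (B * A), this]

/-- If `η(a) * η(l) = -1` then the continuant of `l` vanishes. -/
lemma etaProd_zero_zero_of_cons {a : ℤ} {l : List ℤ} (h : etaProd (a :: l) = -1) :
    etaProd l 0 0 = 0 := by
  rw [← etaProd_cons_one_zero a, h]; simp

/-- Complementary cyclic segments have equal continuants. -/
lemma etaProd_complement {l m : List ℤ} {p q : ℤ}
    (h : etaProd l * etaProd (p :: (m ++ [q])) = -1) : etaProd l 0 0 = etaProd m 0 0 := by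
  set A := etaProd l
  set B := etaProd (p :: (m ++ [q])) with hB
  have hA : A.adjugate * A = 1 := by rw [adjugate_mul, det_etaProd, one_smul]
  have e : B = -A.adjugate := by
    rw [← one_mul B, ← hA, mul_assoc, h, mul_neg, mul_one]
  have e1 := congrFun (congrFun e 1) 1
  rw [adjugate_fin_two] at e1
  simp [hB, etaM, mul_apply, vecMul, dotProduct, Fin.sum_univ_two] at e1
  linarith

/-- `η`-sequences have product `-1` and positive continuants on all segments missing at least
two entries. -/
structure IsPosSeq (c : List ℤ) : Prop where
  prod_eq : etaProd c = -1
  two_le : 2 ≤ c.length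
  pos : ∀ y, y <:+: c → y.length + 2 ≤ c.length → 0 < etaProd y 0 0

namespace IsPosSeq

lemma rotate {c : List ℤ} (h : IsPosSeq c) : IsPosSeq (c.rotate 1) := by
  obtain ⟨hp, h2, hpos⟩ := h
  obtain - | ⟨a, t⟩ := c
  · simp at h2
  have hrot : (a :: t).rotate 1 = t ++ [a] := by simp
  rw [hrot]
  refine ⟨?_, by simpa using h2, fun y hy hl => ?_⟩
  · rw [etaProd_append]
    apply mul_eq_neg_one_comm
    simpa using hp
  rw [List.infix_concat_iff] at hy
  rcases hy with hy | hy
  · rw [List.suffix_concat_iff] at hy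
    rcases hy with rfl | ⟨y, rfl, x, rfl⟩
    · simp
    simp only [List.length_append, List.length_singleton] at hl
    obtain - | ⟨p, x⟩ := x
    · simp at hl
    obtain rfl | ⟨m, q, rfl⟩ := List.eq_nil_or_concat' x
    · simp at hl
      omega
    have hc : etaProd (y ++ [a]) * etaProd (p :: (m ++ [q])) = -1 := by
      apply mul_eq_neg_one_comm
      rw [← etaProd_append]
      rw [← List.singleton_append, etaProd_append] at hp
      have := mul_eq_neg_one_comm hp
      rw [← etaProd_append] at this
      simpa using this
    rw [etaProd_complement hc]
    refine hpos m ⟨[a, p], q :: y, by simp⟩ ?_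
    simp
  · exact hpos y (hy.trans (List.suffix_cons a t).isInfix) (by simpa using hl)

lemma reverse {c : List ℤ} (h : IsPosSeq c) : IsPosSeq c.reverse := by
  obtain ⟨hp, h2, hpos⟩ := h
  refine ⟨?_, by simpa using h2, fun y hy hl => ?_⟩
  · rw [etaProd_reverse, hp]
    ext i j
    fin_cases i <;> fin_cases j <;> simp [mul_apply, Fin.sum_univ_two]
  · rw [← etaProd_reverse_zero_zero]
    refine hpos _ ?_ (by simpa using hl)
    rw [← List.reverse_infix]
    simpa using hy

lemma expand {a b : ℤ} {t : List ℤ} (h : IsPosSeq (a :: b :: t)) :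
    IsPosSeq ((a + 1) :: 1 :: (b + 1) :: t) := by
  obtain ⟨hp, h2, hpos⟩ := h
  have hpos' : ∀ y, y <:+: a :: b :: t → y.length ≤ t.length → 0 < etaProd y 0 0 :=
    fun y hy hl => hpos y hy (by simpa using hl)
  have ht : t <:+: a :: b :: t := ⟨[a, b], [], by simp⟩
  refine ⟨by rw [etaProd_expand, hp], by simp, fun y hy hl => ?_⟩
  simp only [List.length_cons, Nat.add_le_add_iff_right] at hl
  rw [List.infix_cons_iff, List.infix_cons_iff, List.infix_cons_iff] at hy
  rcases hy with hy | hy | hy | hy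
  · rw [List.prefix_cons_iff] at hy
    rcases hy with rfl | ⟨y, rfl, hy⟩
    · simp
    rw [List.prefix_cons_iff] at hy
    rcases hy with rfl | ⟨y, rfl, hy⟩
    · have ha : 0 ≤ a := by
        obtain - | ⟨d, t⟩ := t
        · have := congrFun (congrFun hp 0) 1
          simp [etaM, mul_apply, Fin.sum_univ_two] at this
          omega
        · have := hpos' [a] ⟨[], b :: d :: t, by simp⟩ (by simp)
          simp [etaM] at this
          omega
      simp [etaM]; omega
    rw [List.prefix_cons_iff] at hy
    rcases hy with rfl | ⟨y, rfl, z, rfl⟩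
    · have := hpos' [a] ⟨[], b :: t, by simp⟩ (by simp at hl ⊢; omega)
      simpa [etaM, mul_apply, Fin.sum_univ_two] using this
    · rw [etaProd_expand]
      exact hpos' _ ⟨[], z, by simp⟩ (by simp at hl ⊢; omega)
  · rw [List.prefix_cons_iff] at hy
    rcases hy with rfl | ⟨y, rfl, hy⟩
    · simp
    rw [List.prefix_cons_iff] at hy
    rcases hy with rfl | ⟨y, rfl, z, rfl⟩
    · simp [etaM]
    · have := hpos' (b :: y) ⟨[a], z, by simp⟩ (by simp at hl ⊢; omega)
      rw [etaProd_cons_zero_zero, etaProd_cons_one_zero, etaProd_add_one_cons_zero_zero]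
      linarith
  · rw [List.prefix_cons_iff] at hy
    rcases hy with rfl | ⟨y, rfl, z, rfl⟩
    · simp
    have hy := hpos' y ⟨[a, b], z, by simp⟩ (by simp)
    rw [etaProd_add_one_cons_zero_zero]
    obtain - | ⟨d, z⟩ := z
    · have := etaProd_zero_zero_of_cons hp
      simp only [List.append_nil] at this
      omega
    · have := hpos' (b :: y) ⟨[a], d :: z, by simp⟩ (by simp)
      omega
  · exact hpos' y (hy.trans ht) hy.length_le

end IsPosSeq

lemma IsEta.isPosSeq {c : List ℤ} (h : IsEta c) : IsPosSeq c := by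
  induction h with
  | base =>
    refine ⟨?_, by simp, fun y _ hl => ?_⟩
    · ext i j
      fin_cases i <;> fin_cases j <;> simp [mul_apply, Fin.sum_univ_two, etaM]
    · simp only [List.length_cons, List.length_nil] at hl
      obtain rfl := List.length_eq_zero_iff.mp (by omega : y.length = 0)
      simp
  | rotate _ ih => exact ih.rotate
  | reverse _ ih => exact ih.reverse
  | expand _ ih => exact ih.expand

lemma phi_comm (c : List ℤ) (i j : ℕ) : phi c i j = phi c j i := by
  unfold phi
  split_ifs <;> first | rfl | omega

/-- `φ_i(j)` is the determinant of the first columns of two initial products. -/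
lemma phi_eq_det (c : List ℤ) {i j : ℕ} (hi : 1 ≤ i) (hij : i < j) :
    phi c i j = etaProd (c.take (i - 1)) 0 0 * etaProd (c.take (j - 1)) 1 0
      - etaProd (c.take (i - 1)) 1 0 * etaProd (c.take (j - 1)) 0 0 := by
  have hs : c.take (j - 1) = c.take (i - 1) ++ (c.drop (i - 1)).take (j - i) := by
    rw [← List.take_add]; congr 1; omega
  have hd := det_etaProd (c.take (i - 1))
  rw [det_fin_two] at hd
  have hphi : phi c i j = etaProd ((c.drop (i - 1)).take (j - i)) 1 0 := by
    simp [phi, etaProd, hij, hij.ne]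
  rw [hs, hphi, etaProd_append, mul_apply, mul_apply]
  simp only [Fin.sum_univ_two]
  linear_combination (-etaProd ((c.drop (i - 1)).take (j - i)) 1 0) * hd

lemma IsPosSeq.phi_pos {c : List ℤ} (h : IsPosSeq c) {i j : ℕ} (hi : 1 ≤ i) (hij : i < j)
    (hj : j ≤ c.length) : 0 < phi c i j := by
  have hphi : phi c i j = etaProd ((c.drop (i - 1)).take (j - i)) 1 0 := by
    simp [phi, etaProd, hij, hij.ne]
  have hinf : (c.drop (i - 1)).take (j - i) <:+: c :=
    (List.take_prefix _ _).isInfix.trans (List.drop_suffix _ _).isInfix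
  have hlen : ((c.drop (i - 1)).take (j - i)).length = j - i := by simp; omega
  rw [hphi]
  generalize (c.drop (i - 1)).take (j - i) = y at hinf hlen
  obtain - | ⟨a, y⟩ := y
  · simp at hlen; omega
  rw [etaProd_cons_one_zero]
  refine h.pos y ((List.suffix_cons a y).isInfix.trans hinf) ?_
  simp at hlen; omega

/-- Two vectors of the plane parallel to the same nonzero vector are parallel. -/
lemma det_eq_zero_of_parallel {x y x' y' p q : ℤ} (h : x * q = y * p) (h' : x' * q = y' * p)
    (hpq : ¬ (p = 0 ∧ q = 0)) : x * y' - y * x' = 0 := by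
  have hp : (x * y' - y * x') * p = 0 := by linear_combination x' * h - x * h'
  have hq : (x * y' - y * x') * q = 0 := by linear_combination y' * h - y * h'
  rcases mul_eq_zero.mp hp with h0 | h0
  · exact h0
  · exact (mul_eq_zero.mp hq).resolve_right fun h1 => hpq ⟨h0, h1⟩

/-- Two distinct solutions of `φ_i(a) = φ_i(b)` cannot both lie strictly between `a` and `b`, nor
both lie outside. -/
lemma IsPosSeq.phi_eq_separated {c : List ℤ} (h : IsPosSeq c) {a b i j : ℕ} (ha : 1 ≤ a)
    (hab : a < b) (hb : b ≤ c.length) (hi : 1 ≤ i) (hij : i < j) (hj : j ≤ c.length)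
    (hia : phi c i a = phi c i b) (hja : phi c j a = phi c j b) :
    (i < a ∧ a < j ∧ j < b) ∨ (a < i ∧ i < b ∧ b < j) := by
  set u : ℕ → ℤ := fun k => etaProd (c.take (k - 1)) 0 0
  set w : ℕ → ℤ := fun k => etaProd (c.take (k - 1)) 1 0
  have hdet : ∀ {k l}, 1 ≤ k → k < l → phi c k l = u k * w l - w k * u l :=
    fun hk hkl => phi_eq_det c hk hkl
  have hposab := h.phi_pos ha hab hb
  have hposij := h.phi_pos hi hij hj
  have habdet := hdet ha hab
  rw [hdet hi hij] at hposij
  have hself : ∀ k, phi c k k = 0 := fun k => by simp [phi]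
  have hne : ∀ {k}, phi c k a = phi c k b → k ≠ a ∧ k ≠ b := by
    rintro k hk
    constructor
    · rintro rfl
      rw [hself] at hk; omega
    · rintro rfl
      rw [hself, phi_comm] at hk; omega
  have hout : ∀ {k}, 1 ≤ k → phi c k a = phi c k b → k < a ∨ b < k →
      u k * (w a - w b) = w k * (u a - u b) := by
    rintro k hk he (hka | hkb)
    · rw [hdet hk hka, hdet hk (hka.trans hab)] at he
      linear_combination he
    · rw [phi_comm c k, phi_comm c k, hdet ha (hab.trans hkb), hdet (ha.trans hab.le) hkb] at he
      linear_combination -he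
  have hin : ∀ {k}, 1 ≤ k → phi c k a = phi c k b → a < k → k < b →
      u k * (w a + w b) = w k * (u a + u b) := by
    intro k hk he hak hkb
    rw [phi_comm c k a, hdet ha hak, hdet hk hkb] at he
    linear_combination -he
  obtain ⟨hia', hib'⟩ := hne hia
  obtain ⟨hja', hjb'⟩ := hne hja
  by_cases hi' : a < i ∧ i < b <;> by_cases hj' : a < j ∧ j < b
  · have := det_eq_zero_of_parallel (hin hi hia hi'.1 hi'.2) (hin (hi.trans hij.le) hja hj'.1 hj'.2)
      (fun ⟨h0, h1⟩ => by
        rw [show u a = - u b by linarith, show w a = - w b by linarith] at habdet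
        linarith)
    omega
  · omega
  · omega
  · have := det_eq_zero_of_parallel (hout hi hia (by omega)) (hout (hi.trans hij.le) hja (by omega))
      (fun ⟨h0, h1⟩ => by
        rw [show u a = u b by linarith, show w a = w b by linarith] at habdet
        linarith)
    omega

theorem ears_eq_set_card (c : List ℤ) (h : IsEta c) (e₁ e₂ : ℕ)
    (h1 : 1 ≤ e₁) (h12 : e₁ < e₂) (h2 : e₂ ≤ c.length)
    (he₁ : entryOf c e₁ = 1) (he₂ : entryOf c e₂ = 1) :
    ((Finset.Icc 1 c.length).filter (fun i => phi c i e₁ = phi c i e₂)).card ≤ 2 ∧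
    ∀ i ∈ (Finset.Icc 1 c.length).filter (fun i => phi c i e₁ = phi c i e₂),
      ∀ j ∈ (Finset.Icc 1 c.length).filter (fun i => phi c i e₁ = phi c i e₂),
        i < j → ((i < e₁ ∧ e₁ < j) ∨ (i < e₂ ∧ e₂ < j)) ∧ 1 < j - i := by
  have hsep : ∀ i ∈ (Finset.Icc 1 c.length).filter (fun i => phi c i e₁ = phi c i e₂),
      ∀ j ∈ (Finset.Icc 1 c.length).filter (fun i => phi c i e₁ = phi c i e₂),
        i < j → (i < e₁ ∧ e₁ < j ∧ j < e₂) ∨ (e₁ < i ∧ i < e₂ ∧ e₂ < j) := by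
    intro i hi j hj hij
    simp only [Finset.mem_filter, Finset.mem_Icc] at hi hj
    exact h.isPosSeq.phi_eq_separated h1 h12 h2 hi.1.1 hij hj.1.2 hi.2 hj.2
  refine ⟨?_, fun i hi j hj hij => ?_⟩
  · by_contra! hcard
    obtain ⟨x, y, z, hx, hy, hz, hxy, hxz, hyz⟩ := Finset.two_lt_card_iff.mp hcard
    have key : ∀ p ∈ (Finset.Icc 1 c.length).filter (fun i => phi c i e₁ = phi c i e₂),
        ∀ q ∈ (Finset.Icc 1 c.length).filter (fun i => phi c i e₁ = phi c i e₂), p ≠ q →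
          ((e₁ < p ∧ p < e₂) ↔ ¬ (e₁ < q ∧ q < e₂)) := by
      intro p hp q hq hpq
      rcases lt_or_gt_of_ne hpq with hlt | hlt
      · have := hsep p hp q hq hlt
        omega
      · have := hsep q hq p hp hlt
        omega
    have := key x hx y hy hxy
    have := key x hx z hz hxz
    have := key y hy z hz hyz
    tauto
  · have := hsep i hi j hj hij
    omega
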